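/- Let 𝓕(x) = (x^k + b)^n + c·∑_{i=1}^{n} a^{i-1} (x^k + b)^{n-i} ∈ ℤ[x] be irreducible of degree nk over ℚ, let θ be a root of 𝓕, and K = ℚ(θ). Let p be a prime divisor of the discriminant 𝔇_𝓕 with p ∣ c. Then p does not divide the index [ℤ_K : ℤ[θ]] if and only if p² ∤ a^{n−1} c. -/

import Mathlib

open Polynomial

/-- `D` is the discriminant of the integer polynomial `f`: writing the roots of `f`
in `ℂ` as `θ_1, …, θ_d` (so that `f` splits as `∏ (X - θ_i)` over `ℂ`),
`D = ∏_{i < j} (θ_i - θ_j)^2`. -/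
def IsDiscriminant (f : Polynomial ℤ) (D : ℤ) : Prop :=
  ∃ θ : Fin f.natDegree → ℂ,
    f.map (algebraMap ℤ ℂ) = ∏ i, (X - C (θ i)) ∧
      (D : ℂ) = ∏ i, ∏ j ∈ Finset.Ioi i, (θ i - θ j) ^ 2

theorem Polynomial.map_castRingHom_zmod_eq_zero_iff (p : ℕ) (f : ℤ[X]) :
    f.map (Int.castRingHom (ZMod p)) = 0 ↔ C (p : ℤ) ∣ f := by
  rw [C_dvd_iff_dvd_coeff, Polynomial.ext_iff]
  simp [ZMod.intCast_zmod_eq_zero_iff_dvd]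

theorem Polynomial.exists_eq_add_C_mul_of_map_zmod_eq {p : ℕ} {f g : ℤ[X]}
    (h : f.map (Int.castRingHom (ZMod p)) = g.map (Int.castRingHom (ZMod p))) :
    ∃ r : ℤ[X], f = g + C (p : ℤ) * r := by
  obtain ⟨r, hr⟩ := (map_castRingHom_zmod_eq_zero_iff p (f - g)).1 (by simp [h])
  exact ⟨r, by rw [← hr]; ring⟩

theorem Polynomial.map_zmod_surjective (p : ℕ) :
    Function.Surjective (Polynomial.map (Int.castRingHom (ZMod p))) :=
  Polynomial.map_surjective _ ZMod.intCast_surjective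

theorem Polynomial.exists_irreducible_mul_eq_of_not_dvd {k : Type*} [Field k] {f g : k[X]}
    (hf : f ≠ 0) (h : ¬ f ∣ g) :
    ∃ φ q y H : k[X], Irreducible φ ∧ φ * H = f ∧ g * q + f * y = H := by
  classical
  obtain ⟨e, he⟩ := EuclideanDomain.gcd_dvd_right g f
  have he0 : e ≠ 0 := by
    rintro rfl
    exact hf (by simpa using he)
  have heu : ¬ IsUnit e := by
    intro hu
    apply h
    rw [he, hu.mul_right_dvd]
    exact EuclideanDomain.gcd_dvd_left g f
  obtain ⟨φ, hφ, e', rfl⟩ := WfDvdMonoid.exists_irreducible_factor heu he0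
  refine ⟨φ, EuclideanDomain.gcdA g f * e', EuclideanDomain.gcdB g f * e',
    EuclideanDomain.gcd g f * e', hφ, ?_, ?_⟩
  · conv_rhs => rw [he]
    ring
  · conv_rhs => rw [EuclideanDomain.gcd_eq_gcd_ab]
    ring

theorem Polynomial.span_C_prime_pair_ne_top {p : ℕ} [Fact p.Prime] {φ : ℤ[X]}
    (hφ : Irreducible (φ.map (Int.castRingHom (ZMod p)))) :
    Ideal.span {C (p : ℤ), φ} ≠ ⊤ := by
  intro h
  rw [Ideal.eq_top_iff_one, Ideal.mem_span_pair] at h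
  obtain ⟨x, y, hxy⟩ := h
  have := congrArg (Polynomial.map (Int.castRingHom (ZMod p))) hxy
  simp only [Polynomial.map_add, Polynomial.map_mul, Polynomial.map_one, map_C, Int.coe_castRingHom,
    Int.cast_natCast, CharP.cast_eq_zero, map_zero, mul_zero, zero_add] at this
  exact hφ.not_isUnit (IsUnit.of_mul_eq_one_right _ this)

/-- If `F ≡ G ^ n` modulo `p` and the constant `u` of `(F - G ^ n) / p` modulo `G` is prime to `p`,
then `ℤ[θ]` is `p`-saturated. -/
theorem exists_aeval_eq_of_prime_mul_eq_aeval {O : Type*} [CommRing O] [IsDomain O] [CharZero O]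
    [Algebra.IsIntegral ℤ O] {θ : O} {p n : ℕ} (hp : p.Prime) {F G V : ℤ[X]} {u : ℤ}
    (hF : F = G ^ (n + 2) + C (p : ℤ) * (C u + G * V)) (hFm : F.Monic)
    (hker : ∀ B : ℤ[X], aeval θ B = 0 ↔ F ∣ B) (hu : ¬ (p : ℤ) ∣ u)
    {α : O} {B : ℤ[X]} (hα : (p : O) * α = aeval θ B) : ∃ A : ℤ[X], aeval θ A = α := by
  have : Fact p.Prime := ⟨hp⟩
  have hp0 : (p : O) ≠ 0 := by exact_mod_cast hp.ne_zero
  set m := Polynomial.map (Int.castRingHom (ZMod p)) with hm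
  have hFm' : m F = m G ^ (n + 2) := by simp [hm, hF]
  by_cases hdvd : m F ∣ m B
  · obtain ⟨q', hq⟩ := hdvd
    obtain ⟨q, rfl⟩ := map_zmod_surjective p q'
    obtain ⟨A, hA⟩ := exists_eq_add_C_mul_of_map_zmod_eq (p := p) (f := B) (g := F * q)
      (by rw [Polynomial.map_mul]; exact hq)
    refine ⟨A, mul_left_cancel₀ hp0 ?_⟩
    rw [hα, hA]
    simp [(hker F).2 dvd_rfl]
  exfalso
  obtain ⟨φ', q', y', H', hφ, hH, hgcd⟩ :=
    exists_irreducible_mul_eq_of_not_dvd (hFm.map _).ne_zero hdvd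
  obtain ⟨φ, rfl⟩ := map_zmod_surjective p φ'
  obtain ⟨q, rfl⟩ := map_zmod_surjective p q'
  obtain ⟨y, rfl⟩ := map_zmod_surjective p y'
  obtain ⟨T', hT⟩ : m φ ∣ m G := hφ.prime.dvd_of_dvd_pow (n := n + 2) ⟨H', by rw [← hFm']; exact hH.symm⟩
  obtain ⟨T, rfl⟩ := map_zmod_surjective p T'
  obtain rfl : H' = m G ^ (n + 1) * m T := by
    apply mul_left_cancel₀ hφ.ne_zero
    refine hH.trans (hFm'.trans ?_)
    have hT' : m G = m φ * m T := hT
    linear_combination m G ^ (n + 1) * hT'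
  obtain ⟨r, hr⟩ := exists_eq_add_C_mul_of_map_zmod_eq (p := p) (f := G) (g := φ * T)
    (by rw [Polynomial.map_mul]; exact hT)
  obtain ⟨s, hs⟩ := exists_eq_add_C_mul_of_map_zmod_eq (p := p) (f := B * q + F * y)
    (g := G ^ (n + 1) * T) (by simpa using hgcd)
  have hF0 := (hker F).2 dvd_rfl
  have hF1 := hF0
  rw [hF] at hF1
  have er := congrArg (aeval θ) hr
  have es := congrArg (aeval θ) hs
  simp only [map_add, map_mul, map_pow, hF0, ← hα, aeval_C, algebraMap_int_eq, Int.coe_castRingHom,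
    Int.cast_natCast, zero_mul, add_zero] at er es hF1
  set γ := aeval θ G
  have key : (u : O) = - (aeval θ φ * (α * aeval θ q - aeval θ s)) -
      γ * (aeval θ V + γ ^ n * aeval θ r) := by
    apply mul_left_cancel₀ hp0
    linear_combination hF1 + aeval θ φ * es - γ ^ (n + 1) * er
  have hI := span_C_prime_pair_ne_top hφ
  have hint : (aeval θ : ℤ[X] →ₐ[ℤ] O).toRingHom.IsIntegral := by
    apply RingHom.IsIntegral.tower_top (algebraMap ℤ ℤ[X])
    have : (aeval θ : ℤ[X] →ₐ[ℤ] O).toRingHom.comp (algebraMap ℤ ℤ[X]) = algebraMap ℤ O :=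
      RingHom.ext_int _ _
    rw [this]
    exact algebraMap_isIntegral_iff.2 inferInstance
  have hGI : G ∈ Ideal.span {C (p : ℤ), φ} := Ideal.mem_span_pair.2 ⟨r, T, by rw [hr]; ring⟩
  have hpI : C (p : ℤ) ∈ Ideal.span {C (p : ℤ), φ} := Ideal.subset_span (by simp)
  have hφI : φ ∈ Ideal.span {C (p : ℤ), φ} := Ideal.subset_span (by simp)
  have hFI : F ∈ Ideal.span {C (p : ℤ), φ} := by
    rw [hF]
    exact add_mem (Ideal.pow_mem_of_mem _ hGI _ (by simp)) (Ideal.mul_mem_right _ _ hpI)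
  apply hI
  rw [← Ideal.map_eq_top_iff_of_ker_le _ _ hint, Ideal.eq_top_iff_one]
  · set J := Ideal.map (aeval θ : ℤ[X] →ₐ[ℤ] O).toRingHom (Ideal.span {C (p : ℤ), φ})
    have hGJ : γ ∈ J := Ideal.mem_map_of_mem (aeval θ : ℤ[X] →ₐ[ℤ] O).toRingHom hGI
    have hφJ : aeval θ φ ∈ J := Ideal.mem_map_of_mem (aeval θ : ℤ[X] →ₐ[ℤ] O).toRingHom hφI
    have hpJ : (p : O) ∈ J := by
      have hpJ := Ideal.mem_map_of_mem (aeval θ : ℤ[X] →ₐ[ℤ] O).toRingHom hpI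
      have e : (aeval θ : ℤ[X] →ₐ[ℤ] O).toRingHom (C (p : ℤ)) = (p : O) := by
        change aeval θ (C (p : ℤ)) = _
        rw [aeval_C]
        simp
      rwa [e] at hpJ
    have huJ : (u : O) ∈ J := by
      rw [key]
      exact sub_mem (neg_mem (Ideal.mul_mem_right _ _ hφJ)) (Ideal.mul_mem_right _ _ hGJ)
    obtain ⟨x, z, hxz⟩ := (Nat.prime_iff_prime_int.1 hp).coprime_iff_not_dvd.2 hu
    have h1 : (1 : O) = x * p + z * u := by exact_mod_cast hxz.symm
    rw [h1]
    exact add_mem (Ideal.mul_mem_left _ _ hpJ) (Ideal.mul_mem_left _ _ huJ)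
  · intro x hx
    obtain ⟨w, rfl⟩ := (hker x).1 hx
    exact Ideal.mul_mem_right _ _ hFI

theorem exists_prime_mul_eq_aeval_of_dvd {K : Type*} [Field K] [NumberField K]
    {θ : NumberField.RingOfIntegers K} {p n : ℕ} (hp : p.Prime) {F G V : ℤ[X]} {u : ℤ}
    (hF : F = G ^ (n + 2) + C (p : ℤ) * (C u + G * V)) (hFm : F.Monic) (hF1 : F ≠ 1)
    (hker : ∀ B : ℤ[X], aeval θ B = 0 ↔ F ∣ B) (hu : (p : ℤ) ∣ u) :
    ∃ (α : NumberField.RingOfIntegers K) (B : ℤ[X]), (p : NumberField.RingOfIntegers K) * α =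
      aeval θ B ∧ ∀ A : ℤ[X], aeval θ A ≠ α := by
  have : Fact p.Prime := ⟨hp⟩
  have hpK : (p : K) ≠ 0 := by exact_mod_cast hp.ne_zero
  set m := Polynomial.map (Int.castRingHom (ZMod p)) with hm
  have hFm' : m F = m G ^ (n + 2) := by simp [hm, hF]
  have hG0 : m G ≠ 0 := by
    intro h
    exact (hFm.map (Int.castRingHom (ZMod p))).ne_zero (by change m F = 0; rw [hFm', h]; simp)
  have hGu : ¬ IsUnit (m G) := by
    intro h
    have h2 : IsUnit (m F) := by rw [hFm']; exact h.pow _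
    have h3 := (hFm.map (Int.castRingHom (ZMod p))).eq_one_of_isUnit h2
    apply hF1
    apply hFm.eq_one_of_map_eq_one _ h3
  obtain ⟨φ', hφ, T', hT⟩ := WfDvdMonoid.exists_irreducible_factor hGu hG0
  obtain ⟨φ, rfl⟩ := map_zmod_surjective p φ'
  obtain ⟨T, rfl⟩ := map_zmod_surjective p T'
  obtain ⟨r, hr⟩ := exists_eq_add_C_mul_of_map_zmod_eq (p := p) (f := G) (g := φ * T)
    (by rw [Polynomial.map_mul]; exact hT)
  obtain ⟨u', rfl⟩ := hu
  have hF0 : aeval (θ : K) F = 0 := by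
    have h := congrArg (algebraMap (NumberField.RingOfIntegers K) K) ((hker F).2 dvd_rfl)
    rwa [← aeval_algebraMap_apply, map_zero] at h
  rw [hF] at hF0
  have er := congrArg (aeval (θ : K)) hr
  simp only [map_add, map_mul, map_pow, aeval_C, algebraMap_int_eq, Int.coe_castRingHom,
    Int.cast_natCast] at er hF0
  set S := Algebra.adjoin ℤ {(θ : K)} with hS
  have hmem (A : ℤ[X]) : aeval (θ : K) A ∈ S := aeval_mem_adjoin_singleton _ _
  have hSint : Algebra.IsIntegral ℤ S := Algebra.IsIntegral.adjoin (by
    rintro x rfl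
    exact θ.isIntegral_coe)
  set γ := aeval (θ : K) G with hγ
  let α : K := γ ^ (n + 1) * aeval (θ : K) T / p
  have hpα : p * α = γ ^ (n + 1) * aeval (θ : K) T := by simp only [α]; field_simp
  have hφα : α * aeval (θ : K) φ = - (p * u' + γ * aeval (θ : K) V) -
      γ ^ (n + 1) * aeval (θ : K) r := by
    apply mul_left_cancel₀ hpK
    linear_combination aeval (θ : K) φ * hpα - γ ^ (n + 1) * er + hF0
  let N : Submodule S K := Submodule.span S {(p : K), aeval (θ : K) φ}
  have hpN : (p : K) ∈ N := Submodule.subset_span (by simp)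
  have hφN : aeval (θ : K) φ ∈ N := Submodule.subset_span (by simp)
  have hmul (A : ℤ[X]) {x : K} (hx : x ∈ N) : aeval (θ : K) A * x ∈ N :=
    N.smul_mem ⟨_, hmem A⟩ hx
  have hγN (A : ℤ[X]) : aeval (θ : K) A * γ ∈ N := by
    apply hmul
    rw [er]
    have h1 := hmul T hφN
    have h2 := hmul r hpN
    rw [mul_comm] at h1 h2
    exact add_mem h1 h2
  have hαint : IsIntegral S α := by
    refine isIntegral_of_smul_mem_submodule N ?_ ?_ α ?_
    · intro h
      rw [h] at hpN
      exact hpK (by simpa using hpN)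
    · exact Submodule.fg_span (by simp)
    · intro x hx
      obtain ⟨s, t, rfl⟩ := Submodule.mem_span_pair.1 hx
      rw [smul_add, smul_comm α s, smul_comm α t]
      refine add_mem (N.smul_mem _ ?_) (N.smul_mem _ ?_)
      · have h := hγN (G ^ n * T)
        rw [smul_eq_mul, mul_comm, hpα]
        convert h using 1
        simp only [map_mul, map_pow, ← hγ]
        ring
      · rw [smul_eq_mul, hφα]
        have h1 := hmul (C u') hpN
        have h2 := hγN V
        have h3 := hγN (G ^ n * r)
        simp only [map_mul, map_pow, ← hγ, aeval_C, algebraMap_int_eq, Int.coe_castRingHom] at h1 h2 h3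
        convert sub_mem (neg_mem (add_mem h1 h2)) h3 using 1
        ring
  have hαZ : IsIntegral ℤ α := isIntegral_trans α hαint
  have hinj := NumberField.RingOfIntegers.coe_injective (K := K)
  have hcoe (A : ℤ[X]) : algebraMap (NumberField.RingOfIntegers K) K (aeval θ A) = aeval (θ : K) A :=
    (aeval_algebraMap_apply K θ A).symm
  obtain ⟨α', hα'⟩ : ∃ α' : NumberField.RingOfIntegers K, algebraMap _ K α' = α :=
    IsIntegralClosure.isIntegral_iff.1 hαZ
  refine ⟨α', G ^ (n + 1) * T, hinj ?_, ?_⟩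
  · rw [hcoe]
    rw [map_mul, map_natCast, hα']
    refine hpα.trans ?_
    rw [map_mul, map_pow]
  · intro A hA
    have h1 : aeval θ (G ^ (n + 1) * T - C (p : ℤ) * A) = 0 := by
      apply hinj
      rw [hcoe, map_zero]
      have hA' : aeval (θ : K) A = α := by rw [← hcoe, hA, hα']
      rw [map_sub, map_mul, map_mul, map_pow, hA', aeval_C, ← hγ, ← hpα]
      simp
    obtain ⟨w, hw⟩ := (hker _).1 h1
    have h2 : m G ^ (n + 1) * m T = m G ^ (n + 2) * m w := by
      rw [← hFm']
      simpa [hm] using congrArg m hw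
    have h3 : m T = m G * m w := by
      apply mul_left_cancel₀ (pow_ne_zero (n + 1) hG0)
      rw [h2]; ring
    have hT0 : m T ≠ 0 := by
      intro h
      apply hG0
      rw [hT]
      change _ * m T = 0
      rw [h, mul_zero]
    apply hφ.not_isUnit
    apply IsUnit.of_mul_eq_one (m w)
    apply mul_left_cancel₀ hT0
    change m T * (m φ * m w) = _
    conv_rhs => rw [mul_one, h3, hT]
    change _ = m φ * m T * _
    ring

theorem Algebra.adjoin_int_finite_quotient {K : Type*} [Field K] [NumberField K]
    (θ : NumberField.RingOfIntegers K) (hgen : Algebra.adjoin ℚ {(θ : K)} = ⊤) :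
    Finite (NumberField.RingOfIntegers K ⧸ (Algebra.adjoin ℤ {θ}).toSubring.toAddSubgroup) := by
  let M := Subalgebra.toSubmodule (Algebra.adjoin ℤ {θ})
  change Finite (NumberField.RingOfIntegers K ⧸ M)
  apply Module.finite_of_fg_torsion
  intro x
  obtain ⟨x, rfl⟩ := M.mkQ_surjective x
  have hx : (x : K) ∈ Algebra.adjoin ℚ {(θ : K)} := hgen ▸ Algebra.mem_top
  rw [Algebra.adjoin_singleton_eq_range_aeval] at hx
  obtain ⟨q, hq⟩ := hx
  obtain ⟨b, hb, hb'⟩ := IsLocalization.integerNormalization_spec (nonZeroDivisors ℤ) q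
  refine ⟨⟨b, hb⟩, ?_⟩
  rw [Submonoid.smul_def, ← map_smul]
  apply (Submodule.Quotient.mk_eq_zero M).2
  have : b • x = aeval θ (IsLocalization.integerNormalization (nonZeroDivisors ℤ) q) := by
    apply NumberField.RingOfIntegers.coe_injective (K := K)
    rw [← aeval_algebraMap_apply, ← aeval_map_algebraMap ℚ, hb']
    rw [map_zsmul, map_zsmul]
    exact congrArg (b • ·) hq.symm
  rw [this]
  exact aeval_mem_adjoin_singleton _ _

theorem prime_dvd_index_adjoin_iff {K : Type*} [Field K] [NumberField K]
    (θ : NumberField.RingOfIntegers K) (hgen : Algebra.adjoin ℚ {(θ : K)} = ⊤)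
    {p : ℕ} (hp : p.Prime) :
    p ∣ (Algebra.adjoin ℤ {θ}).toSubring.toAddSubgroup.index ↔
      ∃ (α : NumberField.RingOfIntegers K) (B : ℤ[X]), (p : NumberField.RingOfIntegers K) * α =
      aeval θ B ∧ ∀ A : ℤ[X], aeval θ A ≠ α := by
  have : Fact p.Prime := ⟨hp⟩
  have := Algebra.adjoin_int_finite_quotient θ hgen
  set M := (Algebra.adjoin ℤ {θ}).toSubring.toAddSubgroup with hM
  have hmem (x : NumberField.RingOfIntegers K) : x ∈ M ↔ ∃ A : ℤ[X], aeval θ A = x := by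
    change x ∈ Algebra.adjoin ℤ {θ} ↔ _
    rw [Algebra.adjoin_singleton_eq_range_aeval]
    rfl
  constructor
  · intro h
    obtain ⟨y, hy⟩ := exists_prime_addOrderOf_dvd_card' p h
    obtain ⟨α, rfl⟩ := QuotientAddGroup.mk_surjective y
    have h1 : p • α ∈ M := by
      rw [← QuotientAddGroup.eq_zero_iff, QuotientAddGroup.mk_nsmul, ← hy,
        addOrderOf_nsmul_eq_zero]
    obtain ⟨B, hB⟩ := (hmem _).1 h1
    refine ⟨α, B, by rw [hB, nsmul_eq_mul], fun A hA => ?_⟩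
    have h2 := (QuotientAddGroup.eq_zero_iff α).2 ((hmem α).2 ⟨A, hA⟩)
    rw [h2, addOrderOf_zero] at hy
    exact hp.one_lt.ne hy
  · rintro ⟨α, B, hB, hA⟩
    have h1 : addOrderOf (α : NumberField.RingOfIntegers K ⧸ M) = p := by
      apply addOrderOf_eq_prime
      · rw [← QuotientAddGroup.mk_nsmul, QuotientAddGroup.eq_zero_iff, nsmul_eq_mul, hB]
        exact (hmem _).2 ⟨B, rfl⟩
      · rw [Ne, QuotientAddGroup.eq_zero_iff, hmem]
        exact fun ⟨A, h⟩ => hA A h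
    conv_lhs => rw [← h1]
    exact addOrderOf_dvd_natCard _

theorem aeval_eq_zero_iff_dvd_of_irreducible_map {K : Type*} [Field K] [NumberField K]
    {θ : NumberField.RingOfIntegers K} {F : ℤ[X]} (hFm : F.Monic)
    (hFirr : Irreducible (F.map (algebraMap ℤ ℚ))) (hθ : aeval θ F = 0) (B : ℤ[X]) :
    aeval θ B = 0 ↔ F ∣ B := by
  have hint : IsIntegral ℤ θ := ⟨F, hFm, hθ⟩
  have hassoc : minpoly ℤ θ = F := by
    have h := minpoly.isIntegrallyClosed_dvd hint hθ
    have hirr := hFm.irreducible_iff_irreducible_map_fraction_map (K := ℚ) |>.2 hFirr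
    exact eq_of_monic_of_associated (minpoly.monic hint) hFm
      ((minpoly.irreducible hint).associated_of_dvd hirr h)
  constructor
  · intro h
    rw [← hassoc]
    exact minpoly.isIntegrallyClosed_dvd hint h
  · rintro ⟨w, rfl⟩
    simp [hθ]

theorem stmt_10
    (n k : ℕ) (hn : 3 ≤ n) (hk : 1 ≤ k) (a b c : ℤ)
    (F : Polynomial ℤ)
    (hF : F = (X ^ k + C b) ^ n +
        C c * ∑ i ∈ Finset.Icc 1 n, C a ^ (i - 1) * (X ^ k + C b) ^ (n - i))
    (hFdeg : F.natDegree = n * k)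
    (hFirr : Irreducible (F.map (algebraMap ℤ ℚ)))
    (K : Type*) [Field K] [NumberField K]
    (θ : NumberField.RingOfIntegers K)
    (hθ : aeval θ F = 0)
    (hgen : Algebra.adjoin ℚ {(θ : K)} = ⊤)
    (D : ℤ) (hD : IsDiscriminant F D)
    (p : ℕ) (hp : p.Prime) (hpD : (p : ℤ) ∣ D)
    (hpc : (p : ℤ) ∣ c) :
    (¬ p ∣ (Algebra.adjoin ℤ {θ}).toSubring.toAddSubgroup.index) ↔
      ¬ (p : ℤ) ^ 2 ∣ a ^ (n - 1) * c := by
  obtain ⟨c', rfl⟩ := hpc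
  obtain ⟨m, rfl⟩ : ∃ m, n = m + 2 := ⟨n - 2, by omega⟩
  set G : ℤ[X] := X ^ k + C b with hG
  have hGm : G.Monic := monic_X_pow_add_C b (by omega)
  have hGdeg : G.natDegree = k := natDegree_X_pow_add_C
  let U : ℤ[X] := ∑ i ∈ Finset.Icc 1 (m + 1), C a ^ (i - 1) * G ^ (m + 1 - i)
  have hsum : ∑ i ∈ Finset.Icc 1 (m + 2), C a ^ (i - 1) * G ^ (m + 2 - i) =
      C (a ^ (m + 1)) + G * U := by
    rw [Finset.sum_Icc_succ_top (by omega), Finset.mul_sum, add_comm]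
    congr 1
    · simp
    · refine Finset.sum_congr rfl fun i hi => ?_
      rw [Finset.mem_Icc] at hi
      rw [show m + 2 - i = (m + 1 - i) + 1 by omega]
      ring
  have hF' : F = G ^ (m + 2) + C (p : ℤ) * (C (c' * a ^ (m + 1)) + G * (C c' * U)) := by
    rw [hF, hsum]
    simp only [map_mul]
    ring
  have hlt : (C ((p : ℤ) * c') * ∑ i ∈ Finset.Icc 1 (m + 2), C a ^ (i - 1) *
      G ^ (m + 2 - i)).degree < (G ^ (m + 2)).degree := by
    rw [degree_eq_natDegree (hGm.pow _).ne_zero, natDegree_pow, hGdeg]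
    rw [← smul_eq_C_mul]
    refine (degree_smul_le _ _).trans_lt ((degree_sum_le _ _).trans_lt ?_)
    rw [Finset.sup_lt_iff (WithBot.bot_lt_coe _)]
    intro i hi
    rw [Finset.mem_Icc] at hi
    rw [← C_pow, ← smul_eq_C_mul]
    refine (degree_smul_le _ _).trans_lt ?_
    rw [degree_eq_natDegree (hGm.pow _).ne_zero, natDegree_pow, hGdeg]
    exact_mod_cast Nat.mul_lt_mul_of_pos_right (by omega) (by omega)
  have hFm : F.Monic := by
    rw [hF]
    exact (hGm.pow _).add_of_left hlt
  have hF1 : F ≠ 1 := by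
    rintro rfl
    simp at hFirr
  have hker := aeval_eq_zero_iff_dvd_of_irreducible_map hFm hFirr hθ
  have hdvd : (p : ℤ) ^ 2 ∣ a ^ (m + 2 - 1) * (p * c') ↔ (p : ℤ) ∣ c' * a ^ (m + 1) := by
    rw [show a ^ (m + 2 - 1) * (p * c') = (p : ℤ) * (c' * a ^ (m + 1)) by
      rw [show m + 2 - 1 = m + 1 by omega]; ring, sq]
    exact mul_dvd_mul_iff_left (by exact_mod_cast hp.ne_zero)
  rw [prime_dvd_index_adjoin_iff θ hgen hp, hdvd, not_iff_not]
  constructor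
  · rintro ⟨α, B, hB, hA⟩
    by_contra hu
    obtain ⟨A, h⟩ := exists_aeval_eq_of_prime_mul_eq_aeval hp hF' hFm hker hu hB
    exact hA A h
  · exact exists_prime_mul_eq_aeval_of_dvd hp hF' hFm hF1 hker
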